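/- Let q be an anisotropic nondegenerate quadratic form of rank 4 over a field k of characteristic ≠ 2. Then the base change of q to its own function field k(q) is hyperbolic if and only if the discriminant d(q) is trivial in k×/k×² (equivalently, if and only if q is similar to a 2-fold Pfister form). -/

import Mathlib

open scoped TensorProduct
open Quaternion
set_option synthInstance.maxHeartbeats 1000000
set_option maxHeartbeats 1000000
noncomputable section

universe u v

/-- Upper-triangular coefficient matrix of a quadratic form on `Fin n → R`. -/
def coeffMatrix {R : Type*} [CommRing R] {n : ℕ} (q : QuadraticForm R (Fin n → R)) :
    Matrix (Fin n) (Fin n) R :=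
  Matrix.of fun i j =>
    if i = j then q (Pi.single i 1)
    else if i < j then QuadraticMap.polar q (Pi.single i 1) (Pi.single j 1)
    else 0

/-- Base change of a quadratic form on `Fin n → R` along `R → l`. -/
def extendQF {R : Type*} [CommRing R] {n : ℕ} (q : QuadraticForm R (Fin n → R))
    (l : Type*) [CommRing l] [Algebra R l] : QuadraticForm l (Fin n → l) :=
  ((coeffMatrix q).map (algebraMap R l)).toQuadraticMap'

/-- Gram matrix of the polar bilinear form of `q`. -/
def polarMatrix {R : Type*} [CommRing R] {n : ℕ} (q : QuadraticForm R (Fin n → R)) :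
    Matrix (Fin n) (Fin n) R :=
  Matrix.of fun i j => QuadraticMap.polar q (Pi.single i 1) (Pi.single j 1)

/-- Discriminant: determinant of the Gram matrix (well defined up to squares). -/
def discQF {R : Type*} [CommRing R] {n : ℕ} (q : QuadraticForm R (Fin n → R)) : R :=
  (polarMatrix q).det

/-- Nondegeneracy (char ≠ 2): the Gram determinant is nonzero. -/
def NondegQF {R : Type*} [CommRing R] {n : ℕ} (q : QuadraticForm R (Fin n → R)) : Prop :=
  discQF q ≠ 0

/-- Two quadratic forms are similar if one is isometric to a unit scaling of the other. -/
def SimilarQF {R : Type*} [CommRing R] {n : ℕ} (q q' : QuadraticForm R (Fin n → R)) : Prop :=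
  ∃ c : R, IsUnit c ∧ QuadraticMap.Equivalent (c • q) q'

/-- The polynomial `q(X₁, …, X_{n-1}, 1)` defining the affine quadric. -/
def affineQuadricPoly {R : Type*} [CommRing R] {n : ℕ} (q : QuadraticForm R (Fin n → R)) :
    MvPolynomial (Fin (n - 1)) R :=
  (extendQF q (MvPolynomial (Fin (n - 1)) R))
    (fun i => if h : (i : ℕ) < n - 1 then MvPolynomial.X ⟨i, h⟩ else 1)

/-- Affine coordinate ring `R[x₁,…,x_{n-1}]/(q(x₁,…,x_{n-1},1))` of the quadric. -/
abbrev quadricCoordRing {R : Type*} [CommRing R] {n : ℕ}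
    (q : QuadraticForm R (Fin n → R)) : Type _ :=
  MvPolynomial (Fin (n - 1)) R ⧸ Ideal.span {affineQuadricPoly q}

/-- Function field `k(q)` of the quadric hypersurface `q = 0`. -/
abbrev quadricFunctionField {R : Type*} [CommRing R] {n : ℕ}
    (q : QuadraticForm R (Fin n → R)) : Type _ :=
  FractionRing (quadricCoordRing q)

/-- Affine coordinate ring `k[x,y]/(ax²+by²-1)` of the conic `C_{a,b}`. -/
abbrev conicCoordRing (k : Type*) [Field k] (a b : k) : Type _ :=
  MvPolynomial (Fin 2) k ⧸
    Ideal.span {(MvPolynomial.C a * MvPolynomial.X 0 ^ 2 +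
      MvPolynomial.C b * MvPolynomial.X 1 ^ 2 - 1 : MvPolynomial (Fin 2) k)}

/-- The conic function field `k(C_{a,b})`. -/
abbrev conicFunctionField (k : Type*) [Field k] (a b : k) : Type _ :=
  FractionRing (conicCoordRing k a b)

/-- A `k`-algebra is split if it is isomorphic to a matrix algebra over `k`. -/
def IsSplitAlg (k A : Type*) [Field k] [Ring A] [Algebra k A] : Prop :=
  ∃ n : ℕ, 0 < n ∧ Nonempty (A ≃ₐ[k] Matrix (Fin n) (Fin n) k)

/-- `A` is split by the extension `K/k`: the class of `A` lies in the Brauer kernel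
`κ(K/k) = ker (Br k → Br K)`. -/
def SplitsIn (k : Type*) [Field k] (A : Type*) [Ring A] [Algebra k A]
    (K : Type*) [CommRing K] [Algebra k K] : Prop :=
  ∃ n : ℕ, 0 < n ∧ Nonempty ((K ⊗[k] A) ≃ₐ[K] Matrix (Fin n) (Fin n) K)

/-- Brauer equivalence of two `k`-algebras. -/
def BrauerEquiv (k A B : Type*) [Field k] [Ring A] [Algebra k A] [Ring B] [Algebra k B] :
    Prop :=
  ∃ n m : ℕ, 0 < n ∧ 0 < m ∧
    Nonempty (Matrix (Fin n) (Fin n) A ≃ₐ[k] Matrix (Fin m) (Fin m) B)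

/-- A field is finitely generated (over its prime subfield). -/
def FieldFG (K : Type*) [Field K] : Prop :=
  ∃ s : Finset K, Subfield.closure (s : Set K) = ⊤

/-- Elementary equivalence in the first-order language of rings. -/
def ElemEquivRing (K₁ : Type*) (K₂ : Type*) [CommRing K₁] [CommRing K₂] : Prop :=
  letI := FirstOrder.Ring.compatibleRingOfRing K₁
  letI := FirstOrder.Ring.compatibleRingOfRing K₂
  FirstOrder.Language.ring.ElementarilyEquivalent K₁ K₂

/-- The `m`-fold Pfister form `⟨⟨a₁,…,aₘ⟩⟩ = ⟨1,a₁⟩ ⊗ ⋯ ⊗ ⟨1,aₘ⟩`. -/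
def pfisterForm {k : Type*} [Field k] {m : ℕ} (a : Fin m → k) :
    QuadraticForm k (Fin (2 ^ m) → k) :=
  QuadraticMap.weightedSumSquares k
    (fun j : Fin (2 ^ m) => ∏ i : Fin m, if Nat.testBit (j : ℕ) (i : ℕ) then a i else 1)

section QuadraticExtension

open Polynomial

lemma monic_quadratic {B : Type*} [CommRing B] (l m : B) : (X ^ 2 + C l * X + C m : B[X]).Monic := by
  monicity!

variable {B : Type*} [CommRing B] [IsDomain B]

lemma natDegree_monic_quadratic (l m : B) : (X ^ 2 + C l * X + C m : B[X]).natDegree = 2 := by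
  compute_degree!

/-- A monic quadratic polynomial whose discriminant is not a square is prime. -/
lemma prime_quadratic_of_not_isSquare_discrim [UniqueFactorizationMonoid B] {l m : B}
    (hg : ¬ IsSquare (l ^ 2 - 4 * m)) : Prime (X ^ 2 + C l * X + C m : B[X]) := by
  apply Irreducible.prime
  rw [(monic_quadratic l m).irreducible_iff_roots_eq_zero_of_degree_le_three
    (natDegree_monic_quadratic l m).ge (by rw [natDegree_monic_quadratic]; norm_num)]
  refine Multiset.eq_zero_of_forall_notMem fun r hr => hg ⟨2 * r + l, ?_⟩
  have h := (mem_roots'.1 hr).2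
  simp only [IsRoot.def, eval_add, eval_pow, eval_X, eval_mul, eval_C] at h
  linear_combination -4 * h

lemma exists_linear_sub_dvd (l m : B) (u : B[X]) :
    ∃ u₀ u₁ : B, (X ^ 2 + C l * X + C m : B[X]) ∣ u - (C u₀ + C u₁ * X) := by
  have hm := monic_quadratic l m
  have hlt := natDegree_modByMonic_lt u hm (by
    intro h
    have := natDegree_monic_quadratic l m
    simp [h] at this)
  rw [natDegree_monic_quadratic] at hlt
  obtain ⟨a, b, hab⟩ := exists_eq_X_add_C_of_natDegree_le_one (Nat.le_of_lt_succ hlt)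
  refine ⟨b, a, ?_⟩
  rw [add_comm (C b), ← hab, modByMonic_eq_sub_mul_div, sub_sub_cancel]
  exact dvd_mul_right _ _

lemma linear_eq_zero_of_dvd {l m a b : B}
    (h : (X ^ 2 + C l * X + C m : B[X]) ∣ C a * X + C b) : a = 0 ∧ b = 0 := by
  have h0 : (C a * X + C b : B[X]) = 0 := by
    refine eq_zero_of_dvd_of_natDegree_lt h ?_
    rw [natDegree_monic_quadratic]
    exact lt_of_le_of_lt natDegree_linear_le one_lt_two
  exact ⟨by simpa using congrArg (coeff · 1) h0, by simpa using congrArg (coeff · 0) h0⟩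

/-- If `d` becomes a square in the fraction field of `B[X] / (X² + lX + m)`, then `d` or `d` times
the discriminant is a square in the fraction field of `B`. -/
lemma isSquare_or_discrim_eq_of_dvd [IsIntegrallyClosed B] (h2 : (2 : B) ≠ 0) {l m d : B}
    (hd : IsUnit d) (hg : ¬ IsSquare (l ^ 2 - 4 * m)) {u v : B[X]}
    (huv : (X ^ 2 + C l * X + C m : B[X]) ∣ u ^ 2 - C d * v ^ 2)
    (hv : ¬ (X ^ 2 + C l * X + C m : B[X]) ∣ v) :
    IsSquare d ∨ ∃ r, l ^ 2 - 4 * m = d * r ^ 2 := by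
  obtain ⟨u₀, u₁, hu⟩ := exists_linear_sub_dvd l m u
  obtain ⟨v₀, v₁, hv'⟩ := exists_linear_sub_dvd l m v
  have hred : (X ^ 2 + C l * X + C m : B[X]) ∣
      C (2 * u₀ * u₁ - u₁ ^ 2 * l - d * (2 * v₀ * v₁ - v₁ ^ 2 * l)) * X +
        C (u₀ ^ 2 - u₁ ^ 2 * m - d * (v₀ ^ 2 - v₁ ^ 2 * m)) := by
    obtain ⟨e, he⟩ := huv
    obtain ⟨e₁, he₁⟩ := hu
    obtain ⟨e₂, he₂⟩ := hv'
    refine ⟨e - e₁ * (u + (C u₀ + C u₁ * X)) + C d * e₂ * (v + (C v₀ + C v₁ * X))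
      - C (u₁ ^ 2) + C (d * v₁ ^ 2), ?_⟩
    simp only [map_sub, map_mul, map_pow, map_ofNat]
    linear_combination he - (u + (C u₀ + C u₁ * X)) * he₁ + C d * (v + (C v₀ + C v₁ * X)) * he₂
  obtain ⟨h₁, h₀⟩ := linear_eq_zero_of_dvd hred
  have hv01 : ¬ (v₀ = 0 ∧ v₁ = 0) := by
    rintro ⟨rfl, rfl⟩
    exact hv (by simpa using hv')
  generalize hgg : l ^ 2 - 4 * m = g at *
  obtain ⟨s, hs⟩ : ∃ s, s = 2 * u₀ - u₁ * l := ⟨_, rfl⟩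
  obtain ⟨s', hs'⟩ : ∃ s', s' = 2 * v₀ - v₁ * l := ⟨_, rfl⟩
  have hA : s * u₁ = d * (s' * v₁) := by
    subst hs hs'; linear_combination h₁
  have hB : s ^ 2 + u₁ ^ 2 * g = d * (s' ^ 2 + v₁ ^ 2 * g) := by
    subst hs hs' hgg; linear_combination 4 * h₀ - 2 * l * h₁
  have hN : s' ^ 2 - v₁ ^ 2 * g ≠ 0 := by
    intro h
    by_cases hv1 : v₁ = 0
    · have : s' = 0 := by simpa [hv1] using h
      refine hv01 ⟨?_, hv1⟩
      rw [hs', hv1, zero_mul, sub_zero] at this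
      exact (mul_eq_zero.1 this).resolve_left h2
    · have hdvd : v₁ ^ 2 ∣ s' ^ 2 := ⟨g, by linear_combination h⟩
      obtain ⟨r, rfl⟩ := (IsIntegrallyClosed.pow_dvd_pow_iff two_ne_zero).1 hdvd
      refine hg ⟨r, mul_left_cancel₀ (pow_ne_zero 2 hv1) ?_⟩
      linear_combination -h
  have hS : (s * s' - u₁ * v₁ * g) ^ 2 + (u₁ * s' - s * v₁) ^ 2 * g =
      d * (s' ^ 2 - v₁ ^ 2 * g) ^ 2 := by
    linear_combination (s' ^ 2 + v₁ ^ 2 * g) * hB - 4 * g * s' * v₁ * hA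
  have hT : (s * s' - u₁ * v₁ * g) * (u₁ * s' - s * v₁) = 0 := by
    linear_combination (s' ^ 2 + v₁ ^ 2 * g) * hA - s' * v₁ * hB
  generalize s * s' - u₁ * v₁ * g = S at *
  generalize u₁ * s' - s * v₁ = T at *
  generalize s' ^ 2 - v₁ ^ 2 * g = N at *
  rcases mul_eq_zero.1 hT with rfl | rfl
  · right
    have hT0 : T ≠ 0 := by
      rintro rfl
      exact mul_ne_zero hd.ne_zero (pow_ne_zero 2 hN) (by linear_combination -hS)
    have hdvd : T ^ 2 ∣ N ^ 2 := (hd.dvd_mul_left).1 ⟨g, by linear_combination -hS⟩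
    obtain ⟨r, rfl⟩ := (IsIntegrallyClosed.pow_dvd_pow_iff two_ne_zero).1 hdvd
    refine ⟨r, mul_left_cancel₀ (pow_ne_zero 2 hT0) ?_⟩
    linear_combination hS
  · left
    have hdvd : N ^ 2 ∣ S ^ 2 := ⟨d, by linear_combination hS⟩
    obtain ⟨r, rfl⟩ := (IsIntegrallyClosed.pow_dvd_pow_iff two_ne_zero).1 hdvd
    refine ⟨r, mul_left_cancel₀ (pow_ne_zero 2 hN) ?_⟩
    linear_combination -hS

end QuadraticExtension

section BaseChange

variable {R : Type*} [CommRing R] {n : ℕ}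

lemma extendQF_eq (q : QuadraticForm R (Fin n → R)) (l : Type*) [CommRing l] [Algebra R l] :
    extendQF q l = LinearMap.BilinMap.toQuadraticMap
      (Matrix.toLinearMap₂' l ((coeffMatrix q).map (algebraMap R l))) :=
  rfl

lemma extendQF_apply (q : QuadraticForm R (Fin n → R)) (l : Type*) [CommRing l] [Algebra R l]
    (v : Fin n → l) :
    extendQF q l v = ∑ i, ∑ j, algebraMap R l (coeffMatrix q i j) * v i * v j := by
  rw [extendQF_eq, LinearMap.BilinMap.toQuadraticMap_apply, Matrix.toLinearMap₂'_apply]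
  refine Finset.sum_congr rfl fun i _ => Finset.sum_congr rfl fun j _ => ?_
  simp
  ring

lemma extendQF_map (q : QuadraticForm R (Fin n → R)) {l l' : Type*} [CommRing l] [CommRing l']
    [Algebra R l] [Algebra R l'] (f : l →ₐ[R] l') (v : Fin n → l) :
    extendQF q l' (fun i => f (v i)) = f (extendQF q l v) := by
  simp [extendQF_apply, map_sum]

lemma polarMatrix_extendQF (q : QuadraticForm R (Fin n → R)) (l : Type*) [CommRing l]
    [Algebra R l] : polarMatrix (extendQF q l) = (polarMatrix q).map (algebraMap R l) := by
  ext i j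
  have h : polarMatrix (extendQF q l) i j =
      algebraMap R l (coeffMatrix q i j) + algebraMap R l (coeffMatrix q j i) := by
    rw [polarMatrix, Matrix.of_apply, extendQF_eq, LinearMap.BilinMap.polar_toQuadraticMap]
    simp only [Matrix.toLinearMap₂'_apply, Pi.single_apply, ite_smul, one_smul, zero_smul,
      Finset.sum_ite_irrel, Finset.sum_const_zero, Finset.sum_ite_eq', Finset.mem_univ, if_true,
      Matrix.map_apply]
  rw [h, ← map_add, Matrix.map_apply]
  congr 1
  simp only [coeffMatrix, polarMatrix, Matrix.of_apply]
  rcases lt_trichotomy i j with hij | rfl | hij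
  · simp [hij.ne, hij.ne', hij, hij.asymm]
  · simp [QuadraticMap.polar_self, two_mul]
  · simp [hij.ne, hij.ne', hij, hij.asymm, QuadraticMap.polar_comm]

lemma polarMatrix_eq_toMatrix (q : QuadraticForm R (Fin n → R)) :
    polarMatrix q = LinearMap.toMatrix₂' R q.polarBilin := by
  ext i j
  simp [polarMatrix, LinearMap.toMatrix₂'_apply]

lemma discQF_extendQF (q : QuadraticForm R (Fin n → R)) (l : Type*) [CommRing l] [Algebra R l] :
    discQF (extendQF q l) = algebraMap R l (discQF q) := by
  rw [discQF, polarMatrix_extendQF, discQF, RingHom.map_det, RingHom.mapMatrix_apply]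

lemma eq_of_polarMatrix_eq (h2 : IsUnit (2 : R)) {q q' : QuadraticForm R (Fin n → R)}
    (h : polarMatrix q = polarMatrix q') : q = q' := by
  rw [polarMatrix_eq_toMatrix, polarMatrix_eq_toMatrix, EmbeddingLike.apply_eq_iff_eq] at h
  ext x
  have hx := LinearMap.congr_fun₂ h x x
  simp only [QuadraticMap.polarBilin_apply_apply, QuadraticMap.polar_self, two_smul] at hx
  exact h2.mul_left_cancel (by linear_combination hx)

lemma extendQF_self (h2 : IsUnit (2 : R)) (q : QuadraticForm R (Fin n → R)) :
    extendQF q R = q :=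
  eq_of_polarMatrix_eq h2 (by rw [polarMatrix_extendQF]; ext; simp)

/-- The discriminants of equivalent forms differ by the square of a unit. -/
lemma discQF_of_equivalent {q q' : QuadraticForm R (Fin n → R)}
    (h : QuadraticMap.Equivalent q q') : ∃ t : R, IsUnit t ∧ discQF q = t ^ 2 * discQF q' := by
  obtain ⟨f⟩ := h
  have hq : q.polarBilin = q'.polarBilin.compl₁₂ f.toLinearEquiv.toLinearMap
      f.toLinearEquiv.toLinearMap := by
    ext x y
    simp [QuadraticMap.polar, ← map_add]
  refine ⟨_, LinearEquiv.isUnit_det' f.toLinearEquiv, ?_⟩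
  rw [discQF, discQF, polarMatrix_eq_toMatrix, polarMatrix_eq_toMatrix, hq,
    LinearMap.toMatrix₂'_compl₁₂, Matrix.det_mul, Matrix.det_mul, Matrix.det_transpose,
    LinearMap.det_toMatrix']
  ring

lemma discQF_smul (c : R) (q : QuadraticForm R (Fin n → R)) :
    discQF (c • q) = c ^ n * discQF q := by
  have : polarMatrix (c • q) = c • polarMatrix q := by
    ext i j
    simp [polarMatrix, QuadraticMap.polar_smul]
  rw [discQF, this, Matrix.det_smul, Fintype.card_fin, discQF]

lemma polarMatrix_weightedSumSquares (w : Fin n → R) :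
    polarMatrix (QuadraticMap.weightedSumSquares R w) = Matrix.diagonal fun i => 2 * w i := by
  ext i j
  rcases eq_or_ne i j with rfl | hij
  · simp [polarMatrix, QuadraticMap.polar_self, QuadraticMap.weightedSumSquares_apply,
      Pi.single_apply]
  · rw [Matrix.diagonal_apply_ne _ hij]
    simp only [polarMatrix, Matrix.of_apply, QuadraticMap.polar,
      QuadraticMap.weightedSumSquares_apply, ← Finset.sum_sub_distrib]
    refine Finset.sum_eq_zero fun x _ => ?_
    by_cases h1 : x = i
    · simp [h1, hij]
    · simp [h1]

lemma discQF_weightedSumSquares (w : Fin n → R) :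
    discQF (QuadraticMap.weightedSumSquares R w) = 2 ^ n * ∏ i, w i := by
  rw [discQF, polarMatrix_weightedSumSquares, Matrix.det_diagonal, Finset.prod_mul_distrib]
  simp

lemma extendQF_weightedSumSquares (w : Fin n → R) {l : Type*} [CommRing l] [Algebra R l]
    (h2 : IsUnit (2 : l)) :
    extendQF (QuadraticMap.weightedSumSquares R w) l =
      QuadraticMap.weightedSumSquares l fun i => algebraMap R l (w i) := by
  apply eq_of_polarMatrix_eq h2
  rw [polarMatrix_extendQF, polarMatrix_weightedSumSquares, polarMatrix_weightedSumSquares,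
    Matrix.diagonal_map (map_zero _)]
  simp [map_ofNat (algebraMap R l) 2]

end BaseChange

section DiagonalForms

open QuadraticMap

variable {K : Type*} [Field K]

/-- A linear endomorphism carrying one diagonal form into another is an isometry, provided that
the first form is nondegenerate. -/
lemma equivalent_weightedSumSquares_of_endo (h2 : (2 : K) ≠ 0) {n : ℕ} {w w' : Fin n → K}
    (hw : ∀ i, w i ≠ 0) (f : (Fin n → K) →ₗ[K] (Fin n → K))
    (hf : ∀ x, weightedSumSquares K w' (f x) = weightedSumSquares K w x) :
    Equivalent (weightedSumSquares K w) (weightedSumSquares K w') := by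
  have hinj : Function.Injective f := by
    rw [← LinearMap.ker_eq_bot, LinearMap.ker_eq_bot']
    intro x hx
    ext i
    have h := hf (x + Pi.single i 1)
    rw [map_add, hx, zero_add, hf] at h
    have h0 := hf x
    rw [hx, map_zero] at h0
    have hp : polar (weightedSumSquares K w) x (Pi.single i 1) = 2 * (w i * x i) := by
      simp only [polar, weightedSumSquares_apply, ← Finset.sum_sub_distrib]
      rw [Finset.sum_eq_single i]
      · simp; ring
      · intro j _ hj
        simp [hj]
      · simp
    have : 2 * (w i * x i) = 0 := by
      rw [← hp, polar, ← h, ← h0]; ring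
    simpa [h2, hw i] using this
  exact ⟨{ LinearEquiv.ofInjectiveEndo f hinj with map_app' := hf }⟩

lemma equivalent_weightedSumSquares_of_scale (h2 : (2 : K) ≠ 0) {n : ℕ} {w w' : Fin n → K}
    (hw : ∀ i, w i ≠ 0) (u : Fin n → K) (hu : ∀ i, w i = w' i * u i ^ 2) :
    Equivalent (weightedSumSquares K w) (weightedSumSquares K w') := by
  refine equivalent_weightedSumSquares_of_endo h2 hw (Matrix.toLin' (Matrix.diagonal u)) fun x => ?_
  simp only [weightedSumSquares_apply, Matrix.toLin'_apply, Matrix.mulVec_diagonal, hu,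
    smul_eq_mul]
  exact Finset.sum_congr rfl fun i _ => by ring

/-- An orthogonal sum `⟨e, -e, f, -f⟩` is a sum of two hyperbolic planes. -/
lemma equivalent_hyperbolic (h2 : (2 : K) ≠ 0) {e f : K} (he : e ≠ 0) (hf : f ≠ 0) :
    Equivalent (weightedSumSquares K ![e, -e, f, -f]) (weightedSumSquares K (![1, -1, 1, -1] : Fin 4 → K)) := by
  have hw : ∀ i, ![e, -e, f, -f] i ≠ 0 := by simp [Fin.forall_fin_succ, he, hf]
  refine equivalent_weightedSumSquares_of_endo h2 hw
    (Matrix.toLin' !![(1 + e) / 2, (1 - e) / 2, 0, 0; (1 - e) / 2, (1 + e) / 2, 0, 0;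
      0, 0, (1 + f) / 2, (1 - f) / 2; 0, 0, (1 - f) / 2, (1 + f) / 2]) fun x => ?_
  simp [weightedSumSquares_apply, Fin.sum_univ_four, dotProduct]
  field_simp
  ring

/-- A nondegenerate quaternary form with square discriminant is similar to a Pfister form. -/
lemma exists_equivalent_scaled_pfister (h2 : (2 : K) ≠ 0) {q : QuadraticForm K (Fin 4 → K)}
    (hq : NondegQF q) (hd : IsSquare (discQF q)) :
    ∃ a b c : K, a ≠ 0 ∧ b ≠ 0 ∧ c ≠ 0 ∧
      Equivalent q (weightedSumSquares K ![c, c * a, c * b, c * (a * b)]) := by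
  have : Invertible (2 : K) := invertibleOfNonzero h2
  have hex := QuadraticForm.equivalent_weightedSumSquares q
  rw [Module.finrank_fin_fun] at hex
  obtain ⟨w, hw⟩ := hex
  obtain ⟨t, ht, htq⟩ := discQF_of_equivalent hw
  rw [discQF_weightedSumSquares, Fin.prod_univ_four] at htq
  have hw0 : ∀ i, w i ≠ 0 := by
    have := hq
    simp only [NondegQF, htq, ne_eq, mul_eq_zero, not_or] at this
    simp [Fin.forall_fin_succ]
    tauto
  obtain ⟨r, hr⟩ := hd
  have ht0 := ht.ne_zero
  have h0 := hw0 0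
  have h1 := hw0 1
  have h2' := hw0 2
  have h3 := hw0 3
  refine ⟨w 0 * w 1, w 0 * w 2, w 0, mul_ne_zero h0 h1, mul_ne_zero h0 h2', h0,
    hw.trans (equivalent_weightedSumSquares_of_scale h2 hw0
      ![1, (w 0)⁻¹, (w 0)⁻¹, r / (4 * t * (w 0 ^ 2 * w 1 * w 2))] ?_)⟩
  have h4 : (4 : K) ≠ 0 := by
    rw [show (4 : K) = 2 * 2 by norm_num]; exact mul_ne_zero h2 h2
  simp only [Fin.forall_fin_succ, IsEmpty.forall_iff, and_true]
  refine ⟨by simp, ?_, ?_, ?_⟩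
  · simp; field_simp
  · simp; field_simp
  · simp
    field_simp
    rw [show r ^ 2 = r * r from sq r, ← hr, htq]
    ring

/-- An isotropic multiple of a Pfister form is hyperbolic: either `⟨1, a⟩` is isotropic, or `-b` is
a value of `⟨1, a⟩` and therefore a similarity factor of it. -/
lemma isotropic_pfister_equivalent_hyperbolic (h2 : (2 : K) ≠ 0) {a b c : K} (ha : a ≠ 0)
    (hb : b ≠ 0) (hc : c ≠ 0)
    (hiso : ¬ (weightedSumSquares K ![c, c * a, c * b, c * (a * b)]).Anisotropic) :
    Equivalent (weightedSumSquares K ![c, c * a, c * b, c * (a * b)])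
      (weightedSumSquares K (![1, -1, 1, -1] : Fin 4 → K)) := by
  have hw0 : ∀ i, ![c, c * a, c * b, c * (a * b)] i ≠ 0 := by
    simp [Fin.forall_fin_succ, ha, hb, hc]
  by_cases hs : IsSquare (-a)
  · obtain ⟨s, hs⟩ := hs
    refine (equivalent_weightedSumSquares_of_scale h2 hw0 ![1, s, 1, s] ?_).trans
      (equivalent_hyperbolic h2 hc (mul_ne_zero hc hb))
    have : a = -(s * s) := by rw [← hs, neg_neg]
    simp [Fin.forall_fin_succ, this]
    ring_nf
    simp
  have hN : ∀ x y : K, x ^ 2 + a * y ^ 2 = 0 → x = 0 ∧ y = 0 := by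
    intro x y h
    by_cases hy : y = 0
    · subst hy
      exact ⟨by simpa using h, rfl⟩
    · refine absurd ⟨x / y, ?_⟩ hs
      field_simp
      linear_combination -h
  simp only [Anisotropic, not_forall] at hiso
  obtain ⟨x, hx, hx0⟩ := hiso
  simp only [weightedSumSquares_apply, Fin.sum_univ_four] at hx
  simp at hx
  have hx' : (x 0 ^ 2 + a * x 1 ^ 2) + b * (x 2 ^ 2 + a * x 3 ^ 2) = 0 :=
    mul_left_cancel₀ hc (by linear_combination hx)
  have hM : x 0 ^ 2 + a * x 1 ^ 2 ≠ 0 := by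
    intro h
    have h' : x 2 ^ 2 + a * x 3 ^ 2 = 0 := by simpa [h, hb] using hx'
    obtain ⟨h0, h1⟩ := hN _ _ h
    obtain ⟨h2, h3⟩ := hN _ _ h'
    exact hx0 (by ext i; fin_cases i <;> simp [h0, h1, h2, h3])
  have hM' : x 2 ^ 2 + a * x 3 ^ 2 ≠ 0 := by
    intro h
    rw [h, mul_zero, add_zero] at hx'
    exact hM hx'
  obtain ⟨y, z, hyz⟩ : ∃ y z : K, b = -(y ^ 2 + a * z ^ 2) := by
    refine ⟨(x 0 * x 2 + a * x 1 * x 3) / (x 2 ^ 2 + a * x 3 ^ 2),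
      (x 1 * x 2 - x 0 * x 3) / (x 2 ^ 2 + a * x 3 ^ 2), ?_⟩
    field_simp
    linear_combination (x 2 ^ 2 + a * x 3 ^ 2) * hx'
  refine (equivalent_weightedSumSquares_of_endo h2 hw0 (Matrix.toLin' !![1, 0, 0, 0;
    0, 0, y, -(a * z); 0, 1, 0, 0; 0, 0, z, y]) fun v => ?_).trans
    (equivalent_hyperbolic h2 hc (mul_ne_zero hc ha))
  simp [weightedSumSquares_apply, Fin.sum_univ_four, dotProduct]
  rw [hyz]
  ring

/-- A nondegenerate isotropic quaternary form with square discriminant is hyperbolic. -/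
lemma equivalent_hyperbolic_of_isotropic (h2 : (2 : K) ≠ 0) {q : QuadraticForm K (Fin 4 → K)}
    (hq : NondegQF q) (hd : IsSquare (discQF q)) (hiso : ¬ q.Anisotropic) :
    Equivalent q (weightedSumSquares K (![1, -1, 1, -1] : Fin 4 → K)) := by
  obtain ⟨a, b, c, ha, hb, hc, h⟩ := exists_equivalent_scaled_pfister h2 hq hd
  refine h.trans (isotropic_pfister_equivalent_hyperbolic h2 ha hb hc fun han => hiso ?_)
  obtain ⟨f⟩ := h
  intro x hx
  have := han (f x) (by rw [f.map_app, hx])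
  simpa using congrArg f.symm this

end DiagonalForms

section FunctionField

variable {k : Type*} [Field k]

lemma apply_eq_of_coeffMatrix (h2 : (2 : k) ≠ 0) (q : QuadraticForm k (Fin 4 → k))
    (v : Fin 4 → k) :
    q v = coeffMatrix q 0 0 * v 0 ^ 2 + coeffMatrix q 1 1 * v 1 ^ 2 + coeffMatrix q 2 2 * v 2 ^ 2 +
      coeffMatrix q 3 3 * v 3 ^ 2 + coeffMatrix q 0 1 * (v 0 * v 1) +
      coeffMatrix q 0 2 * (v 0 * v 2) + coeffMatrix q 0 3 * (v 0 * v 3) +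
      coeffMatrix q 1 2 * (v 1 * v 2) + coeffMatrix q 1 3 * (v 1 * v 3) +
      coeffMatrix q 2 3 * (v 2 * v 3) := by
  have hlow : ∀ i j, j < i → coeffMatrix q i j = 0 := fun i j h => by
    simp [coeffMatrix, h.ne', h.asymm]
  conv_lhs => rw [← extendQF_self h2.isUnit q, extendQF_apply]
  simp only [Fin.sum_univ_four, Algebra.algebraMap_self, RingHom.id_apply,
    hlow 1 0 (by decide), hlow 2 0 (by decide), hlow 2 1 (by decide), hlow 3 0 (by decide),
    hlow 3 1 (by decide), hlow 3 2 (by decide)]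
  ring

/-- The linear coefficient of the normalized quadric equation, as a polynomial in `X₀`. -/
def quadricLinearCoeff (q : QuadraticForm k (Fin 4 → k)) : MvPolynomial (Fin 2) k :=
  MvPolynomial.C (coeffMatrix q 0 0)⁻¹ * (MvPolynomial.C (coeffMatrix q 0 1) * MvPolynomial.X 0 +
    MvPolynomial.C (coeffMatrix q 0 2) * MvPolynomial.X 1 + MvPolynomial.C (coeffMatrix q 0 3))

/-- The constant coefficient of the normalized quadric equation, as a polynomial in `X₀`. -/
def quadricConstCoeff (q : QuadraticForm k (Fin 4 → k)) : MvPolynomial (Fin 2) k :=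
  MvPolynomial.C (coeffMatrix q 0 0)⁻¹ *
    (MvPolynomial.C (coeffMatrix q 1 1) * MvPolynomial.X 0 ^ 2 +
      MvPolynomial.C (coeffMatrix q 2 2) * MvPolynomial.X 1 ^ 2 +
      MvPolynomial.C (coeffMatrix q 3 3) +
      MvPolynomial.C (coeffMatrix q 1 2) * (MvPolynomial.X 0 * MvPolynomial.X 1) +
      MvPolynomial.C (coeffMatrix q 1 3) * MvPolynomial.X 0 +
      MvPolynomial.C (coeffMatrix q 2 3) * MvPolynomial.X 1)

/-- The normalized quadric equation, as a monic quadratic polynomial in `X₀`. -/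
def quadricMonicPoly (q : QuadraticForm k (Fin 4 → k)) : Polynomial (MvPolynomial (Fin 2) k) :=
  Polynomial.X ^ 2 + Polynomial.C (quadricLinearCoeff q) * Polynomial.X +
    Polynomial.C (quadricConstCoeff q)

lemma coeffMatrix_zero_zero_ne_zero {q : QuadraticForm k (Fin 4 → k)} (han : q.Anisotropic) :
    coeffMatrix q 0 0 ≠ 0 := by
  intro h
  have := han (Pi.single 0 1) (by simpa [coeffMatrix] using h)
  simpa using congrFun this 0

lemma finSuccEquiv_affineQuadricPoly {q : QuadraticForm k (Fin 4 → k)} (han : q.Anisotropic) :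
    MvPolynomial.finSuccEquiv k 2 (affineQuadricPoly q) =
      Polynomial.C (MvPolynomial.C (coeffMatrix q 0 0)) * quadricMonicPoly q := by
  have hlow : ∀ i j, j < i → coeffMatrix q i j = 0 := fun i j h => by
    simp [coeffMatrix, h.ne', h.asymm]
  have hX₀ : MvPolynomial.finSuccEquiv k 2 (MvPolynomial.X 0) = Polynomial.X :=
    MvPolynomial.finSuccEquiv_X_zero
  have hX₁ : MvPolynomial.finSuccEquiv k 2 (MvPolynomial.X 1) = Polynomial.C (MvPolynomial.X 0) :=
    MvPolynomial.finSuccEquiv_X_succ (j := 0)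
  have hX₂ : MvPolynomial.finSuccEquiv k 2 (MvPolynomial.X 2) = Polynomial.C (MvPolynomial.X 1) :=
    MvPolynomial.finSuccEquiv_X_succ (j := 1)
  have hC : ∀ a : k, MvPolynomial.finSuccEquiv k 2 (algebraMap k (MvPolynomial (Fin 3) k) a) =
      Polynomial.C (MvPolynomial.C a) := fun a => (MvPolynomial.finSuccEquiv k 2).commutes a
  have hc : Polynomial.C (MvPolynomial.C (coeffMatrix q 0 0)) *
      Polynomial.C (MvPolynomial.C (coeffMatrix q 0 0)⁻¹) =
      (1 : Polynomial (MvPolynomial (Fin 2) k)) := by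
    rw [← map_mul, ← map_mul, mul_inv_cancel₀ (coeffMatrix_zero_zero_ne_zero han), map_one, map_one]
  have hP : affineQuadricPoly q = ∑ i, ∑ j,
      algebraMap k (MvPolynomial (Fin 3) k) (coeffMatrix q i j) *
      (![MvPolynomial.X 0, MvPolynomial.X 1, MvPolynomial.X 2, 1] : Fin 4 → _) i *
      (![MvPolynomial.X 0, MvPolynomial.X 1, MvPolynomial.X 2, 1] : Fin 4 → _) j := by
    have hv : (fun i : Fin 4 => if h : (i : ℕ) < 4 - 1 then
        (MvPolynomial.X ⟨i, h⟩ : MvPolynomial (Fin 3) k) else 1) =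
        ![MvPolynomial.X 0, MvPolynomial.X 1, MvPolynomial.X 2, 1] := by
      ext1 i
      fin_cases i <;> rfl
    rw [← hv]
    exact extendQF_apply q _ _
  rw [hP]
  simp only [Fin.sum_univ_four, hlow 1 0 (by decide), hlow 2 0 (by decide),
    hlow 2 1 (by decide), hlow 3 0 (by decide), hlow 3 1 (by decide), hlow 3 2 (by decide),
    Matrix.cons_val_zero, Matrix.cons_val_one, Matrix.cons_val, map_add, map_mul, map_one,
    map_zero, hC, hX₀, hX₁, hX₂, quadricMonicPoly, quadricLinearCoeff, quadricConstCoeff, map_pow]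
  generalize Polynomial.C (MvPolynomial.C (coeffMatrix q 0 0)⁻¹) = e at *
  generalize Polynomial.C (MvPolynomial.C (coeffMatrix q 0 0)) = f at *
  linear_combination
    -((Polynomial.C (MvPolynomial.C (coeffMatrix q 0 1)) * Polynomial.C (MvPolynomial.X 0) +
      Polynomial.C (MvPolynomial.C (coeffMatrix q 0 2)) * Polynomial.C (MvPolynomial.X 1) +
      Polynomial.C (MvPolynomial.C (coeffMatrix q 0 3))) * Polynomial.X +
      (Polynomial.C (MvPolynomial.C (coeffMatrix q 1 1)) * Polynomial.C (MvPolynomial.X 0) ^ 2 +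
      Polynomial.C (MvPolynomial.C (coeffMatrix q 2 2)) * Polynomial.C (MvPolynomial.X 1) ^ 2 +
      Polynomial.C (MvPolynomial.C (coeffMatrix q 3 3)) +
      Polynomial.C (MvPolynomial.C (coeffMatrix q 1 2)) *
        (Polynomial.C (MvPolynomial.X 0) * Polynomial.C (MvPolynomial.X 1)) +
      Polynomial.C (MvPolynomial.C (coeffMatrix q 1 3)) * Polynomial.C (MvPolynomial.X 0) +
      Polynomial.C (MvPolynomial.C (coeffMatrix q 2 3)) * Polynomial.C (MvPolynomial.X 1))) * hc

/-- No nonzero multiple of the discriminant of the quadric equation is a square. -/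
lemma quadric_discrim_ne (h2 : (2 : k) ≠ 0) {q : QuadraticForm k (Fin 4 → k)}
    (han : q.Anisotropic) (d : k) (r : MvPolynomial (Fin 2) k) :
    quadricLinearCoeff q ^ 2 - 4 * quadricConstCoeff q ≠ MvPolynomial.C d * r ^ 2 := by
  intro h
  have hc := coeffMatrix_zero_zero_ne_zero han
  have happ := apply_eq_of_coeffMatrix h2 q
  have h' := congrArg (MvPolynomial.aeval ![(Polynomial.X : Polynomial k), 0]) h
  simp only [quadricLinearCoeff, quadricConstCoeff, map_sub, map_mul, map_pow, map_add,
    MvPolynomial.aeval_X, MvPolynomial.algHom_C, Polynomial.algebraMap_eq, map_ofNat] at h'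
  simp only [Matrix.cons_val_zero, Matrix.cons_val_one] at h'
  set ρ := MvPolynomial.aeval ![(Polynomial.X : Polynomial k), 0] r with hρ
  clear_value ρ
  generalize coeffMatrix q 0 0 = c at *
  generalize coeffMatrix q 0 1 = m01 at *
  generalize coeffMatrix q 1 1 = m11 at *
  generalize coeffMatrix q 1 3 = m13 at *
  generalize coeffMatrix q 0 3 = m03 at *
  generalize coeffMatrix q 3 3 = m33 at *
  have h3 : Polynomial.C (m01 ^ 2 - 4 * c * m11) * Polynomial.X ^ 2 +
      Polynomial.C (2 * m01 * m03 - 4 * c * m13) * Polynomial.X +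
      Polynomial.C (m03 ^ 2 - 4 * c * m33) = Polynomial.C (c ^ 2 * d) * ρ ^ 2 := by
    have hcc : Polynomial.C c * Polynomial.C c⁻¹ = 1 := by
      rw [← map_mul, mul_inv_cancel₀ hc, map_one]
    simp only [map_sub, map_mul, map_pow, map_ofNat]
    generalize Polynomial.C c⁻¹ = e at *
    generalize Polynomial.C c = f at *
    linear_combination f ^ 2 * h' - ((Polynomial.C m01 * Polynomial.X + Polynomial.C m03) ^ 2 *
      (1 + f * e) - 4 * f * (Polynomial.C m11 * Polynomial.X ^ 2 + Polynomial.C m13 * Polynomial.X +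
      Polynomial.C m33)) * hcc
  have hα : m01 ^ 2 - 4 * c * m11 ≠ 0 := by
    intro h0
    have := han ![-m01, 2 * c, 0, 0] (by
      rw [happ]
      simp
      linear_combination -c * h0)
    have := congrFun this 1
    simp [h2, hc] at this
  have hdeg := congrArg Polynomial.natDegree h3
  rw [Polynomial.natDegree_quadratic hα] at hdeg
  have hcd : c ^ 2 * d ≠ 0 := by
    intro h0
    simp [h0] at hdeg
  rw [Polynomial.natDegree_C_mul hcd, Polynomial.natDegree_pow] at hdeg
  obtain ⟨x, hx⟩ := Polynomial.exists_root_of_degree_eq_one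
    ((Polynomial.degree_eq_iff_natDegree_eq_of_pos one_pos).2 (by omega : ρ.natDegree = 1))
  have h4 := congrArg (Polynomial.eval x) h3
  simp [hx.eq_zero] at h4
  have := han ![-(m01 * x + m03), 2 * c * x, 0, 2 * c] (by
    rw [happ]
    simp
    linear_combination -c * h4)
  have := congrFun this 3
  simp [h2, hc] at this

lemma not_isSquare_quadric_discrim (h2 : (2 : k) ≠ 0) {q : QuadraticForm k (Fin 4 → k)}
    (han : q.Anisotropic) : ¬ IsSquare (quadricLinearCoeff q ^ 2 - 4 * quadricConstCoeff q) := by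
  rintro ⟨r, hr⟩
  exact quadric_discrim_ne h2 han 1 r (by rw [hr, map_one]; ring)

lemma affineQuadricPoly_dvd_iff {q : QuadraticForm k (Fin 4 → k)} (han : q.Anisotropic)
    (f : MvPolynomial (Fin 3) k) :
    affineQuadricPoly q ∣ f ↔ quadricMonicPoly q ∣ MvPolynomial.finSuccEquiv k 2 f := by
  have hu : IsUnit (Polynomial.C (MvPolynomial.C (coeffMatrix q 0 0)) :
      Polynomial (MvPolynomial (Fin 2) k)) :=
    ((coeffMatrix_zero_zero_ne_zero han).isUnit.map MvPolynomial.C).map Polynomial.C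
  rw [← hu.mul_left_dvd, ← finSuccEquiv_affineQuadricPoly han]
  exact (map_dvd_iff (MvPolynomial.finSuccEquiv k 2)).symm

lemma prime_quadricMonicPoly (h2 : (2 : k) ≠ 0) {q : QuadraticForm k (Fin 4 → k)}
    (han : q.Anisotropic) : Prime (quadricMonicPoly q) :=
  prime_quadratic_of_not_isSquare_discrim (not_isSquare_quadric_discrim h2 han)

lemma prime_affineQuadricPoly (h2 : (2 : k) ≠ 0) {q : QuadraticForm k (Fin 4 → k)}
    (han : q.Anisotropic) : Prime (affineQuadricPoly q) := by
  have hu : IsUnit (Polynomial.C (MvPolynomial.C (coeffMatrix q 0 0)) :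
      Polynomial (MvPolynomial (Fin 2) k)) :=
    ((coeffMatrix_zero_zero_ne_zero han).isUnit.map MvPolynomial.C).map Polynomial.C
  refine (MulEquiv.prime_iff (MvPolynomial.finSuccEquiv k 2)).1 ?_
  rw [finSuccEquiv_affineQuadricPoly han]
  exact ((associated_unit_mul_left _ _ hu).prime_iff).2 (prime_quadricMonicPoly h2 han)

lemma isDomain_quadricCoordRing (h2 : (2 : k) ≠ 0) {q : QuadraticForm k (Fin 4 → k)}
    (han : q.Anisotropic) : IsDomain (quadricCoordRing q) := by
  have hp := prime_affineQuadricPoly h2 han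
  have : (Ideal.span {affineQuadricPoly q}).IsPrime :=
    (Ideal.span_singleton_prime hp.ne_zero).2 hp
  infer_instance

/-- A scalar which is a square in the function field of an anisotropic quaternary form is already
a square in the base field. -/
lemma isSquare_of_isSquare_functionField (h2 : (2 : k) ≠ 0) {q : QuadraticForm k (Fin 4 → k)}
    (han : q.Anisotropic) {d : k} (hd : d ≠ 0)
    (hsq : IsSquare (algebraMap k (quadricFunctionField q) d)) : IsSquare d := by
  have := isDomain_quadricCoordRing h2 han
  obtain ⟨t, ht⟩ := hsq
  obtain ⟨a, b, hb, rfl⟩ := IsFractionRing.div_surjective (A := quadricCoordRing q) t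
  have hb0 := nonZeroDivisors.ne_zero hb
  have hbK : algebraMap (quadricCoordRing q) (quadricFunctionField q) b ≠ 0 := by
    simpa using hb0
  have hab : a ^ 2 - algebraMap k _ d * b ^ 2 = 0 := by
    apply IsFractionRing.injective (quadricCoordRing q) (quadricFunctionField q)
    rw [IsScalarTower.algebraMap_apply k (quadricCoordRing q) (quadricFunctionField q)] at ht
    field_simp at ht
    simp only [map_sub, map_mul, map_pow, map_zero]
    linear_combination -ht
  obtain ⟨u, rfl⟩ := Ideal.Quotient.mk_surjective a
  obtain ⟨v, rfl⟩ := Ideal.Quotient.mk_surjective b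
  have huv : affineQuadricPoly q ∣ u ^ 2 - MvPolynomial.C d * v ^ 2 := by
    rw [← Ideal.mem_span_singleton, ← Ideal.Quotient.eq_zero_iff_mem]
    rw [map_sub, map_mul, map_pow, map_pow]
    exact hab
  have hv : ¬ affineQuadricPoly q ∣ v := by
    rwa [← Ideal.mem_span_singleton, ← Ideal.Quotient.eq_zero_iff_mem]
  rw [affineQuadricPoly_dvd_iff han] at huv hv
  have hC : MvPolynomial.finSuccEquiv k 2 (MvPolynomial.C d) =
      Polynomial.C (MvPolynomial.C d) := (MvPolynomial.finSuccEquiv k 2).commutes d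
  rw [map_sub, map_mul, map_pow, map_pow, hC] at huv
  have h2' : (2 : MvPolynomial (Fin 2) k) ≠ 0 := by
    rw [← map_ofNat MvPolynomial.C 2]
    simpa using h2
  rcases isSquare_or_discrim_eq_of_dvd h2' (hd.isUnit.map MvPolynomial.C)
    (not_isSquare_quadric_discrim h2 han) huv hv with h | ⟨r, hr⟩
  · simpa using h.map (MvPolynomial.constantCoeff (σ := Fin 2) (R := k))
  · exact absurd hr (quadric_discrim_ne h2 han d r)

/-- A form acquires a nontrivial zero over its function field. -/
lemma not_anisotropic_extendQF_functionField {q : QuadraticForm k (Fin 4 → k)}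
    [IsDomain (quadricCoordRing q)] :
    ¬ (extendQF q (quadricFunctionField q)).Anisotropic := by
  intro h
  let φ : MvPolynomial (Fin (4 - 1)) k →ₐ[k] quadricFunctionField q :=
    (IsScalarTower.toAlgHom k (quadricCoordRing q) (quadricFunctionField q)).comp
      (Ideal.Quotient.mkₐ k _)
  have h0 := h _ ((extendQF_map q φ
    (fun i => if h : (i : ℕ) < 4 - 1 then MvPolynomial.X ⟨i, h⟩ else 1)).trans (by
      change φ (affineQuadricPoly q) = 0
      have : Ideal.Quotient.mk (Ideal.span {affineQuadricPoly q}) (affineQuadricPoly q) = 0 :=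
        Ideal.Quotient.eq_zero_iff_mem.2 (Ideal.mem_span_singleton_self _)
      simp [φ, this]))
  simpa using congrFun h0 3

end FunctionField

theorem stmt_17 (k : Type u) [Field k] (h2 : (2 : k) ≠ 0)
    (q : QuadraticForm k (Fin 4 → k)) (hq : NondegQF q) (han : q.Anisotropic) :
    (QuadraticMap.Equivalent (extendQF q (quadricFunctionField q))
        (extendQF (QuadraticMap.weightedSumSquares k ![1, -1, 1, -1])
          (quadricFunctionField q)) ↔
      IsSquare (discQF q)) ∧
    (IsSquare (discQF q) ↔ ∃ a b c : k, a ≠ 0 ∧ b ≠ 0 ∧ c ≠ 0 ∧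
      QuadraticMap.Equivalent (c • q) (QuadraticMap.weightedSumSquares k ![1, a, b, a * b])) := by
  have hdom := isDomain_quadricCoordRing h2 han
  have h2K : (2 : quadricFunctionField q) ≠ 0 := by
    rw [← map_ofNat (algebraMap k (quadricFunctionField q)) 2]
    exact (map_ne_zero _).2 h2
  have hH : extendQF (QuadraticMap.weightedSumSquares k ![1, -1, 1, -1])
      (quadricFunctionField q) = QuadraticMap.weightedSumSquares (quadricFunctionField q)
        (![1, -1, 1, -1] : Fin 4 → quadricFunctionField q) := by
    have hZ : QuadraticMap.weightedSumSquares k (![1, -1, 1, -1] : Fin 4 → ℤ) =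
        QuadraticMap.weightedSumSquares k (![1, -1, 1, -1] : Fin 4 → k) := by
      ext x
      simp [QuadraticMap.weightedSumSquares_apply, Fin.sum_univ_four]
    rw [hZ, extendQF_weightedSumSquares _ h2K.isUnit]
    congr 1
    ext1 i
    fin_cases i <;> simp
  refine ⟨⟨fun h => ?_, fun h => ?_⟩, fun h => ?_, ?_⟩
  · rw [hH] at h
    obtain ⟨t, -, ht⟩ := discQF_of_equivalent h
    refine isSquare_of_isSquare_functionField h2 han hq ⟨t * 4, ?_⟩
    rw [← discQF_extendQF, ht, discQF_weightedSumSquares, Fin.prod_univ_four]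
    simp
    ring
  · rw [hH]
    refine equivalent_hyperbolic_of_isotropic h2K ?_ ?_ not_anisotropic_extendQF_functionField
    · rw [NondegQF, discQF_extendQF]
      exact (map_ne_zero _).2 hq
    · rw [discQF_extendQF]
      exact h.map _
  · obtain ⟨a, b, c, ha, hb, hc, ⟨f⟩⟩ := exists_equivalent_scaled_pfister h2 hq h
    refine ⟨a, b, c⁻¹, ha, hb, inv_ne_zero hc, ⟨{ f.toLinearEquiv with map_app' := fun x => ?_ }⟩⟩
    change _ = c⁻¹ * q x
    rw [← f.map_app x, eq_inv_mul_iff_mul_eq₀ hc]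
    simp only [QuadraticMap.weightedSumSquares_apply, Fin.sum_univ_four]
    simp
    ring
  · rintro ⟨a, b, c, ha, hb, hc, h⟩
    obtain ⟨t, -, ht⟩ := discQF_of_equivalent h
    rw [discQF_smul, discQF_weightedSumSquares, Fin.prod_univ_four] at ht
    refine ⟨t * 4 * (a * b) / c ^ 2, ?_⟩
    field_simp
    simp at ht
    linear_combination ht

end
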